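/- Let p ∈ (0,∞). For every pair of finite-rank bounded operators A and B on a complex Hilbert space, ∑_{ν≥1} s_ν(AB)^p ≤ 2 (∑_{ν≥1} s_ν(A)^p)(∑_{ν≥1} s_ν(B)^p), where s₁ ≥ s₂ ≥ … denotes the sequence of singular numbers. -/

import Mathlib

open MeasureTheory Filter Set
open scoped ENNReal ComplexOrder

noncomputable section

/-- The open unit disc in `ℂ`. -/
def unitDisc : Set ℂ := Metric.ball (0 : ℂ) 1

/-- Normalized area Lebesgue measure `dA = dx dy / π` on `ℂ`. -/
def dA : Measure ℂ := (ENNReal.ofReal Real.pi)⁻¹ • (volume : Measure ℂ)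

/-- The weighted measure `ω dA` on the unit disc. -/
def muW (ω : ℂ → ℝ) : Measure ℂ :=
  (dA.restrict unitDisc).withDensity fun z => ENNReal.ofReal (ω z)

/-- The radial extension to `𝔻` of a function of `r ∈ [0,1)`. -/
def radialize (τ : ℝ → ℝ) : ℂ → ℝ := fun z => τ ‖z‖

/-- The class `𝓛`, with constants `c₁, c₂`. -/
structure IsClassL (τC : ℂ → ℝ) (c₁ c₂ : ℝ) : Prop where
  c₁_pos : 0 < c₁
  c₂_pos : 0 < c₂
  pos : ∀ z ∈ unitDisc, 0 < τC z
  upper : ∀ z ∈ unitDisc, τC z ≤ c₁ * (1 - ‖z‖)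
  lip : ∀ z ∈ unitDisc, ∀ ζ ∈ unitDisc, |τC z - τC ζ| ≤ c₂ * ‖z - ζ‖

/-- `m_τ = min(1, c₁⁻¹, c₂⁻¹)/4`. -/
def mTau (c₁ c₂ : ℝ) : ℝ := min 1 (min c₁⁻¹ c₂⁻¹) / 4

/-- The Laplacian `Δφ = φ_xx + φ_yy` of a function `φ : ℂ → ℝ`. -/
def laplacian (φ : ℂ → ℝ) (z : ℂ) : ℝ :=
  fderiv ℝ (fun w => fderiv ℝ φ w 1) z 1 +
    fderiv ℝ (fun w => fderiv ℝ φ w Complex.I) z Complex.I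

/-- The Wirtinger derivative `∂̄g = (g_x + i g_y)/2` of `g : ℂ → ℂ`. -/
def dbar (g : ℂ → ℂ) (z : ℂ) : ℂ :=
  (fderiv ℝ g z 1 + Complex.I * fderiv ℝ g z Complex.I) / 2

/-- The class `𝒲` of weights `ω = e^{-2φ}` with associated radial profile `τ`. -/
structure IsClassW (ω φ : ℂ → ℝ) (τ : ℝ → ℝ) : Prop where
  pos : ∀ z ∈ unitDisc, 0 < ω z
  omega_eq : ∀ z ∈ unitDisc, ω z = Real.exp (-(2 * φ z))
  integrable : ∫⁻ z in unitDisc, ENNReal.ofReal (ω z) ∂dA < ⊤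
  radial : ∀ z ∈ unitDisc, ∀ ζ ∈ unitDisc, ‖z‖ = ‖ζ‖ → φ z = φ ζ
  smooth : ContDiffOn ℝ 2 φ unitDisc
  lap_pos : ∀ z ∈ unitDisc, 0 < laplacian φ z
  tau_pos : ∀ r ∈ Set.Ico (0 : ℝ) 1, 0 < τ r
  tau_anti : AntitoneOn τ (Set.Ico 0 1)
  tau_lim : Tendsto τ (nhdsWithin 1 (Set.Iio 1)) (nhds 0)
  tau_diff : ∀ r ∈ Set.Ico (0 : ℝ) 1, DifferentiableAt ℝ τ r
  tau_deriv_lim : Tendsto (deriv τ) (nhdsWithin 1 (Set.Iio 1)) (nhds 0)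
  comp : ∃ C : ℝ, 1 ≤ C ∧ ∀ z ∈ unitDisc,
    τ ‖z‖ / C ≤ (laplacian φ z) ^ (-(1 / 2 : ℝ)) ∧
      (laplacian φ z) ^ (-(1 / 2 : ℝ)) ≤ C * τ ‖z‖
  extra : (∃ C > (0 : ℝ), ∃ r₀ ∈ Set.Ico (0 : ℝ) 1,
      MonotoneOn (fun r => τ r * (1 - r) ^ C) (Set.Ico r₀ 1)) ∨
    Tendsto (fun r => deriv τ r * Real.log (1 / τ r)) (nhdsWithin 1 (Set.Iio 1)) (nhds 0)

/-- A `(δ,τ)`-lattice of the unit disc. -/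
structure IsLattice (τC : ℂ → ℝ) (δ : ℝ) (z : ℕ → ℂ) : Prop where
  mem : ∀ j, z j ∈ unitDisc
  sep : ∀ j k, j ≠ k → z j ∉ Metric.ball (z k) (δ * τC (z k))
  covers : ∀ w ∈ unitDisc, ∃ j, w ∈ Metric.ball (z j) (δ * τC (z j))
  mult : ∃ N : ℕ, ∀ w ∈ unitDisc,
    ({j : ℕ | w ∈ Metric.ball (z j) (3 * (δ * τC (z j)))}).ncard ≤ N

/-- The distance `d_τ(z,ζ) = |z-ζ| / min(τ(z),τ(ζ))`. -/
def dTau (τC : ℂ → ℝ) (z ζ : ℂ) : ℝ := ‖z - ζ‖ / min (τC z) (τC ζ)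

/-- `(1/|D(δτ(z))|) ∫_{D(δτ(z))} |u|² dA`, valued in `ℝ≥0∞`. -/
def localMeanE (τC : ℂ → ℝ) (δ : ℝ) (u : ℂ → ℂ) (z : ℂ) : ℝ≥0∞ :=
  (ENNReal.ofReal ((δ * τC z) ^ 2))⁻¹ *
    ∫⁻ w in Metric.ball z (δ * τC z), ENNReal.ofReal (‖u w‖ ^ 2) ∂dA

/-- `F_δ(z)² = inf over h analytic in D(δτ(z)) of the mean square of g - h`. -/
def FdeltaSqE (τC : ℂ → ℝ) (δ : ℝ) (g : ℂ → ℂ) (z : ℂ) : ℝ≥0∞ :=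
  ⨅ (h : ℂ → ℂ) (_ : DifferentiableOn ℂ h (Metric.ball z (δ * τC z))),
    localMeanE τC δ (fun w => g w - h w) z

/-- The submodule of `L²_ω` of elements with a representative analytic on `𝔻`. -/
def bergmanSubmodule (ω : ℂ → ℝ) : Submodule ℂ (Lp ℂ 2 (muW ω)) where
  carrier := {f | ∃ F : ℂ → ℂ, DifferentiableOn ℂ F unitDisc ∧ (f : ℂ → ℂ) =ᵐ[muW ω] F}
  zero_mem' := ⟨0, differentiableOn_const 0, Lp.coeFn_zero ℂ 2 (muW ω)⟩
  add_mem' := by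
    rintro a b ⟨F, hF, ha⟩ ⟨G, hG, hb⟩
    refine ⟨F + G, hF.add hG, ?_⟩
    filter_upwards [Lp.coeFn_add a b, ha, hb] with w h1 h2 h3
    rw [h1]; simp only [Pi.add_apply, h2, h3]
  smul_mem' := by
    rintro c a ⟨F, hF, ha⟩
    refine ⟨c • F, hF.const_smul c, ?_⟩
    filter_upwards [Lp.coeFn_smul c a, ha] with w h1 h2
    rw [h1]; simp only [Pi.smul_apply, h2]

/-- The Bergman space `A²_ω`, a closed subspace of `L²_ω`. -/
def bergmanH (ω : ℂ → ℝ) : Submodule ℂ (Lp ℂ 2 (muW ω)) :=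
  (bergmanSubmodule ω).topologicalClosure

instance (ω : ℂ → ℝ) : CompleteSpace (bergmanH ω) :=
  IsComplete.completeSpace_coe (Submodule.isClosed_topologicalClosure _).isComplete

/-- The orthogonal (Bergman) projection of `L²_ω` onto `A²_ω`, valued in `A²_ω`. -/
def bergmanProjA (ω : ℂ → ℝ) : Lp ℂ 2 (muW ω) →L[ℂ] bergmanH ω :=
  Submodule.orthogonalProjectionOnto (bergmanH ω)

/-- The Bergman projection `P`, viewed as an operator of `L²_ω`. -/
def bergmanProj (ω : ℂ → ℝ) : Lp ℂ 2 (muW ω) →L[ℂ] Lp ℂ 2 (muW ω) :=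
  (bergmanH ω).subtypeL.comp (bergmanProjA ω)

/-- `T` is a bounded extension of the Hankel operator `H_g : f ↦ g f - P(g f)`,
defined on the bounded analytic functions `f ∈ H^∞`. -/
def IsHankelExtension (ω : ℂ → ℝ) (g : ℂ → ℂ)
    (T : bergmanH ω →L[ℂ] Lp ℂ 2 (muW ω)) : Prop :=
  ∀ (f : bergmanH ω) (F : ℂ → ℂ) (M : ℝ),
    DifferentiableOn ℂ F unitDisc →
    (∀ z ∈ unitDisc, ‖F z‖ ≤ M) →
    ((f : Lp ℂ 2 (muW ω)) : ℂ → ℂ) =ᵐ[muW ω] F →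
    ∀ gF : Lp ℂ 2 (muW ω), ((gF : ℂ → ℂ) =ᵐ[muW ω] fun z => g z * F z) →
    T f = gF - bergmanProj ω gF

/-- The `ν`-th singular number `s_ν(T) = inf{‖T - K‖ : rank K ≤ ν}`, `ν = 0, 1, 2, …`. -/
def singularNumber {E F : Type*} [NormedAddCommGroup E] [NormedSpace ℂ E]
    [NormedAddCommGroup F] [NormedSpace ℂ F] (T : E →L[ℂ] F) (ν : ℕ) : ℝ :=
  sInf {c : ℝ | ∃ K : E →L[ℂ] F,
    Module.rank ℂ (LinearMap.range (K : E →ₗ[ℂ] F)) ≤ (ν : Cardinal) ∧ c = ‖T - K‖}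

/-- `‖T‖_{S^p}^p = ∑_ν s_ν(T)^p`. -/
def schattenSum (p : ℝ) {E F : Type*} [NormedAddCommGroup E] [NormedSpace ℂ E]
    [NormedAddCommGroup F] [NormedSpace ℂ F] (T : E →L[ℂ] F) : ℝ :=
  ∑' ν : ℕ, singularNumber T ν ^ p

/-- Membership in the Schatten class `S^p`: `∑_ν s_ν(T)^p < ∞`. -/
def MemSchatten (p : ℝ) {E F : Type*} [NormedAddCommGroup E] [NormedSpace ℂ E]
    [NormedAddCommGroup F] [NormedSpace ℂ F] (T : E →L[ℂ] F) : Prop :=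
  Summable fun ν : ℕ => singularNumber T ν ^ p

/-- A bounded operator has finite rank. -/
def FiniteRank {E F : Type*} [NormedAddCommGroup E] [NormedSpace ℂ E]
    [NormedAddCommGroup F] [NormedSpace ℂ F] (T : E →L[ℂ] F) : Prop :=
  Module.rank ℂ (LinearMap.range (T : E →ₗ[ℂ] F)) < Cardinal.aleph0

/-- The decay estimate `|F(z)| ω(z)^{1/2} ≲ min(1, min(τ(α),τ(z))/|z-α|)^{3n}` on `𝔻`. -/
def TestDecay (τC ω : ℂ → ℝ) (C₀ : ℝ) (n : ℕ) (α : ℂ) (F : ℂ → ℂ) : Prop :=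
  (∀ z ∈ unitDisc, ‖F z‖ * Real.sqrt (ω z) ≤ C₀) ∧
    ∀ z ∈ unitDisc, z ≠ α → ‖F z‖ * Real.sqrt (ω z) ≤
      C₀ * (min (τC α) (τC z) / ‖z - α‖) ^ (3 * n)

/-- Multiplication of an `L²_ω` element by the indicator of a measurable set `D`. -/
def indLp (ω : ℂ → ℝ) (D : Set ℂ) (hD : MeasurableSet D) (f : Lp ℂ 2 (muW ω)) :
    Lp ℂ 2 (muW ω) :=
  MemLp.toLp (D.indicator f) ((Lp.memLp f).indicator hD)

/-- The subspace of `L²_ω` of elements vanishing a.e. off `D` with a representative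
analytic on `D`;  its closure realizes `A²_ω(D)` inside `L²_ω`. -/
def localBergmanSub (ω : ℂ → ℝ) (D : Set ℂ) : Submodule ℂ (Lp ℂ 2 (muW ω)) where
  carrier := {f | ((f : ℂ → ℂ) =ᵐ[(muW ω).restrict Dᶜ] 0) ∧
    ∃ h : ℂ → ℂ, DifferentiableOn ℂ h D ∧ (f : ℂ → ℂ) =ᵐ[(muW ω).restrict D] h}
  zero_mem' := by
    refine ⟨ae_restrict_of_ae (Lp.coeFn_zero ℂ 2 (muW ω)), 0, differentiableOn_const 0,
      ae_restrict_of_ae (Lp.coeFn_zero ℂ 2 (muW ω))⟩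
  add_mem' := by
    rintro a b ⟨ha0, F, hF, ha⟩ ⟨hb0, G, hG, hb⟩
    refine ⟨?_, F + G, hF.add hG, ?_⟩
    · filter_upwards [ae_restrict_of_ae (Lp.coeFn_add a b), ha0, hb0] with w h1 h2 h3
      rw [h1]; simp only [Pi.add_apply, h2, h3, Pi.zero_apply, add_zero]
    · filter_upwards [ae_restrict_of_ae (Lp.coeFn_add a b), ha, hb] with w h1 h2 h3
      rw [h1]; simp only [Pi.add_apply, h2, h3]
  smul_mem' := by
    rintro c a ⟨ha0, F, hF, ha⟩
    refine ⟨?_, c • F, hF.const_smul c, ?_⟩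
    · filter_upwards [ae_restrict_of_ae (Lp.coeFn_smul c a), ha0] with w h1 h2
      rw [h1]; simp only [Pi.smul_apply, h2, Pi.zero_apply, smul_zero]
    · filter_upwards [ae_restrict_of_ae (Lp.coeFn_smul c a), ha] with w h1 h2
      rw [h1]; simp only [Pi.smul_apply, h2]

instance (ω : ℂ → ℝ) (D : Set ℂ) :
    CompleteSpace ((localBergmanSub ω D).topologicalClosure) :=
  IsComplete.completeSpace_coe (Submodule.isClosed_topologicalClosure _).isComplete

/-- The local projection `P_{α,δ}` (for `D = D(δτ(α))`), extended by zero off `D`,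
viewed as an operator of `L²_ω`. -/
def localProj (ω : ℂ → ℝ) (D : Set ℂ) : Lp ℂ 2 (muW ω) →L[ℂ] Lp ℂ 2 (muW ω) :=
  ((localBergmanSub ω D).topologicalClosure).subtypeL.comp
    (Submodule.orthogonalProjectionOnto ((localBergmanSub ω D).topologicalClosure))

theorem sn_bddBelow {H : Type*} [NormedAddCommGroup H] [InnerProductSpace ℂ H]
    (T : H →L[ℂ] H) (ν : ℕ) : BddBelow {c : ℝ | ∃ K : H →L[ℂ] H,
    Module.rank ℂ (LinearMap.range (K : H →ₗ[ℂ] H)) ≤ (ν : Cardinal) ∧ c = ‖T - K‖} :=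
  ⟨0, by rintro c ⟨K, -, rfl⟩; exact norm_nonneg _⟩

theorem sn_nonempty {H : Type*} [NormedAddCommGroup H] [InnerProductSpace ℂ H]
    (T : H →L[ℂ] H) (ν : ℕ) : {c : ℝ | ∃ K : H →L[ℂ] H,
    Module.rank ℂ (LinearMap.range (K : H →ₗ[ℂ] H)) ≤ (ν : Cardinal) ∧ c = ‖T - K‖}.Nonempty :=
  ⟨_, 0, by
    have : LinearMap.range ((0 : H →L[ℂ] H) : H →ₗ[ℂ] H) = ⊥ := by
      rw [LinearMap.range_eq_bot]; rfl
    rw [this, rank_bot]; exact zero_le, rfl⟩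

theorem sn_nonneg {H : Type*} [NormedAddCommGroup H] [InnerProductSpace ℂ H]
    (T : H →L[ℂ] H) (ν : ℕ) : 0 ≤ singularNumber T ν :=
  Real.sInf_nonneg (by rintro c ⟨K, -, rfl⟩; exact norm_nonneg _)

theorem sn_le {H : Type*} [NormedAddCommGroup H] [InnerProductSpace ℂ H]
    (T K : H →L[ℂ] H) (ν : ℕ)
    (hK : Module.rank ℂ (LinearMap.range (K : H →ₗ[ℂ] H)) ≤ (ν : Cardinal)) :
    singularNumber T ν ≤ ‖T - K‖ :=
  csInf_le (sn_bddBelow T ν) ⟨K, hK, rfl⟩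

theorem sn_anti {H : Type*} [NormedAddCommGroup H] [InnerProductSpace ℂ H]
    (T : H →L[ℂ] H) {m n : ℕ} (h : m ≤ n) : singularNumber T n ≤ singularNumber T m := by
  refine le_csInf (sn_nonempty T m) ?_
  rintro c ⟨K, hK, rfl⟩
  exact sn_le T K n (hK.trans (by exact_mod_cast h))

theorem sn_mul {H : Type*} [NormedAddCommGroup H] [InnerProductSpace ℂ H]
    (A B : H →L[ℂ] H) (m n : ℕ) :
    singularNumber (A ∘L B) (m + n) ≤ singularNumber A m * singularNumber B n := by
  have key : ∀ a' > singularNumber A m, ∀ b' > singularNumber B n,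
      singularNumber (A ∘L B) (m + n) ≤ a' * b' := by
    intro a ha b hb
    obtain ⟨_, ⟨K, hK, rfl⟩, hKa⟩ := exists_lt_of_csInf_lt (sn_nonempty A m) ha
    obtain ⟨_, ⟨L, hL, rfl⟩, hLb⟩ := exists_lt_of_csInf_lt (sn_nonempty B n) hb
    have hr : Module.rank ℂ (LinearMap.range
        ((K ∘L B + (A - K) ∘L L : H →L[ℂ] H) : H →ₗ[ℂ] H)) ≤ ((m + n : ℕ) : Cardinal) := by
      have h1 := LinearMap.rank_add_le ((K : H →ₗ[ℂ] H) ∘ₗ (B : H →ₗ[ℂ] H))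
        (((A - K : H →L[ℂ] H) : H →ₗ[ℂ] H) ∘ₗ (L : H →ₗ[ℂ] H))
      have h2 := LinearMap.rank_comp_le_left (B : H →ₗ[ℂ] H) (K : H →ₗ[ℂ] H)
      have h3 := LinearMap.rank_comp_le_right (L : H →ₗ[ℂ] H) ((A - K : H →L[ℂ] H) : H →ₗ[ℂ] H)
      rw [Nat.cast_add]
      exact h1.trans (add_le_add (h2.trans hK) (h3.trans hL))
    refine (sn_le _ _ _ hr).trans ?_
    have he : A ∘L B - (K ∘L B + (A - K) ∘L L) = (A - K) ∘L (B - L) := by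
      ext x; simp; abel
    rw [he]
    refine (ContinuousLinearMap.opNorm_comp_le _ _).trans ?_
    exact mul_le_mul hKa.le hLb.le (norm_nonneg _) ((norm_nonneg _).trans hKa.le)
  have ht : Tendsto (fun ε : ℝ => (singularNumber A m + ε) * (singularNumber B n + ε))
      (nhdsWithin 0 (Set.Ioi 0)) (nhds ((singularNumber A m + 0) * (singularNumber B n + 0))) :=
    ((by fun_prop : Continuous (fun ε : ℝ =>
      (singularNumber A m + ε) * (singularNumber B n + ε))).tendsto 0).mono_left
        nhdsWithin_le_nhds
  rw [add_zero, add_zero] at ht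
  refine ge_of_tendsto ht ?_
  filter_upwards [self_mem_nhdsWithin] with ε hε
  have hε' : 0 < ε := hε
  exact key _ (by linarith) _ (by linarith)

theorem sn_summable {H : Type*} [NormedAddCommGroup H] [InnerProductSpace ℂ H]
    (T : H →L[ℂ] H) (hT : FiniteRank T) {p : ℝ} (hp : 0 < p) :
    Summable fun ν : ℕ => singularNumber T ν ^ p := by
  obtain ⟨N, hN⟩ := Cardinal.lt_aleph0.1 hT
  refine summable_of_ne_finset_zero (s := Finset.range N) ?_
  intro ν hν
  have h0 : singularNumber T ν = 0 := by
    refine le_antisymm ?_ (sn_nonneg T ν)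
    have := sn_le T T ν (by rw [hN]; exact_mod_cast (by simpa using hν))
    simpa using this
  rw [h0, Real.zero_rpow hp.ne']

theorem seq_bound {a b c : ℕ → ℝ} {p : ℝ} (hp : 0 < p) (ha : ∀ n, 0 ≤ a n) (hb : ∀ n, 0 ≤ b n)
    (hc : ∀ n, 0 ≤ c n) (sA : Summable fun n => a n ^ p) (sB : Summable fun n => b n ^ p)
    (hmul : ∀ k, c (2 * k) ≤ a k * b k) (hanti : ∀ k, c (2 * k + 1) ≤ c (2 * k)) :
    (∑' n, c n ^ p) ≤ 2 * (∑' n, a n ^ p) * (∑' n, b n ^ p) := by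
  have hle : ∀ k, b k ^ p ≤ ∑' n, b n ^ p :=
    fun k => sB.le_tsum k (fun j _ => Real.rpow_nonneg (hb j) p)
  generalize (∑' n, b n ^ p) = S at hle ⊢
  have hev : ∀ k, c (2 * k) ^ p ≤ a k ^ p * S := by
    intro k
    calc c (2 * k) ^ p ≤ (a k * b k) ^ p := Real.rpow_le_rpow (hc _) (hmul k) hp.le
      _ = a k ^ p * b k ^ p := Real.mul_rpow (ha _) (hb _)
      _ ≤ _ := mul_le_mul_of_nonneg_left (hle k) (Real.rpow_nonneg (ha k) p)
  have hod : ∀ k, c (2 * k + 1) ^ p ≤ a k ^ p * S := fun k =>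
    (Real.rpow_le_rpow (hc _) (hanti k) hp.le).trans (hev k)
  have sR := sA.mul_right S
  have se := Summable.of_nonneg_of_le (fun k => Real.rpow_nonneg (hc (2 * k)) p) hev sR
  have so := Summable.of_nonneg_of_le (fun k => Real.rpow_nonneg (hc (2 * k + 1)) p) hod sR
  have e1 := se.tsum_le_tsum hev sR
  have e2 := so.tsum_le_tsum hod sR
  rw [tsum_mul_right] at e1 e2
  have e3 := tsum_even_add_odd (f := fun n => c n ^ p) se so
  linarith

theorem stmt6 {H : Type*} [NormedAddCommGroup H] [InnerProductSpace ℂ H] [CompleteSpace H]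
    (p : ℝ) (hp : 0 < p) (A B : H →L[ℂ] H) (hA : FiniteRank A) (hB : FiniteRank B) :
    (∑' ν : ℕ, singularNumber (A ∘L B) ν ^ p) ≤
      2 * (∑' ν : ℕ, singularNumber A ν ^ p) * (∑' ν : ℕ, singularNumber B ν ^ p) := by
  refine seq_bound hp (sn_nonneg A) (sn_nonneg B) (sn_nonneg (A ∘L B)) (sn_summable A hA hp)
    (sn_summable B hB hp) (fun k => ?_) (fun k => sn_anti (A ∘L B) (Nat.le_succ _))
  rw [two_mul]
  exact sn_mul A B k k

end
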